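/- arXiv:1411.3582 — 2 statements merged into one kernel-verified Lean document; each statement's English description precedes it below -/
import Mathlib

section
/- Let a < b be real numbers and f : [a,b] → ℝ a function. Then the set of discontinuity points of f is at most countable if and only if the set of points of (a,b] at which f does not admit a finite left-hand limit is at most countable. -/
open Set Filter MeasureTheory Topology

/-- If all points of `t` outside a countable set `E` are isolated from the left in `t`, then `t`
is countable. -/
theorem countable_of_left_isolated_off_countable {t E : Set ℝ} (hE : E.Countable)
    (h : ∀ x ∈ t, x ∉ E → ∃ y < x, t ∩ Set.Ioo y x = ∅) : t.Countable := by
  refine (hE.union (countable_setOfPred_isolated_left_within (s := t))).mono fun x hx ↦ ?_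
  by_cases hxE : x ∈ E
  · exact Or.inl hxE
  · obtain ⟨y, hy, hyx⟩ := h x hx hxE
    refine Or.inr ⟨hx, empty_mem_iff_bot.1 (mem_nhdsWithin.2 ⟨Set.Ioi y, isOpen_Ioi, hy, ?_⟩)⟩
    exact fun z hz ↦ hyx.subset ⟨hz.2.1, hz.1, hz.2.2⟩

/-- The points of `s` near which `f` takes, within `s`, values at distance at least `ε` from
its value at the point. -/
def largeOscillationSet (f : ℝ → ℝ) (s : Set ℝ) (ε : ℝ) : Set ℝ :=
  {x ∈ s | ∀ u ∈ 𝓝[s] x, ∃ y ∈ u, ε ≤ |f y - f x|}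

theorem exists_mem_largeOscillationSet {f : ℝ → ℝ} {s : Set ℝ} {x : ℝ} (hx : x ∈ s)
    (hf : ¬ ContinuousWithinAt f s x) : ∃ n : ℕ, x ∈ largeOscillationSet f s (1 / (n + 1)) := by
  by_contra! hn
  refine hf (Metric.tendsto_nhds.2 fun ε hε ↦ ?_)
  obtain ⟨n, hnε⟩ := exists_nat_one_div_lt hε
  have hxn := hn n
  simp only [largeOscillationSet, mem_ofPred_eq, not_and, not_forall, not_exists, not_le] at hxn
  obtain ⟨u, hu, hux⟩ := hxn hx
  filter_upwards [hu] with y hy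
  rw [Real.dist_eq]
  exact (hux y hy).trans hnε

theorem largeOscillationSet_left_isolated {f : ℝ → ℝ} {a b x d ε : ℝ} (hε : 0 < ε)
    (hx : x ∈ Set.Ioc a b) (hd : Tendsto f (𝓝[Set.Ico a x] x) (𝓝 d)) :
    ∃ y < x, largeOscillationSet f (Set.Icc a b) ε ∩ Set.Ioo y x = ∅ := by
  have hev : ∀ᶠ y in 𝓝[<] x, dist (f y) d < ε / 2 := by
    rw [← nhdsWithin_Ico_eq_nhdsLT hx.1]
    exact Metric.tendsto_nhds.1 hd _ (half_pos hε)
  obtain ⟨y, hyx, hy⟩ := (mem_nhdsLT_iff_exists_Ioo_subset).1 hev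
  refine ⟨y, hyx, eq_empty_of_forall_notMem fun z hz ↦ ?_⟩
  obtain ⟨w, hw, hwz⟩ := hz.1.2 _ (mem_nhdsWithin_of_mem_nhds (Ioo_mem_nhds hz.2.1 hz.2.2))
  have hw' : dist (f w) d < ε / 2 := hy hw
  have hz' : dist (f z) d < ε / 2 := hy hz.2
  have := dist_triangle_right (f w) (f z) d
  rw [Real.dist_eq (f w) (f z)] at this
  linarith

/-- For `f : [a,b] → ℝ`, the set of discontinuity points of `f` is at most
countable iff the set of points of `(a,b]` at which `f` does not admit a finite left-hand
limit is at most countable. -/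
theorem countable_discontinuities_iff_countable_left_limits (a b : ℝ) (hab : a < b)
    (f : ℝ → ℝ) :
    {x ∈ Set.Icc a b | ¬ ContinuousWithinAt f (Set.Icc a b) x}.Countable ↔
    {x ∈ Set.Ioc a b |
      ¬ ∃ d : ℝ, Tendsto f (𝓝[Set.Ico a x] x) (𝓝 d)}.Countable := by
  constructor
  · intro h
    refine h.mono fun x hx ↦ ?_
    refine ⟨Ioc_subset_Icc_self hx.1, fun hc ↦ hx.2 ⟨f x, ?_⟩⟩
    exact hc.mono fun y hy ↦ ⟨hy.1, hy.2.le.trans hx.1.2⟩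
  · intro h
    have hn (n : ℕ) : (largeOscillationSet f (Set.Icc a b) (1 / (n + 1))).Countable := by
      refine countable_of_left_isolated_off_countable (h.insert a) fun x hx hxE ↦ ?_
      rw [mem_insert_iff, not_or] at hxE
      have hxab : x ∈ Set.Ioc a b := ⟨lt_of_le_of_ne hx.1.1 (Ne.symm hxE.1), hx.1.2⟩
      obtain ⟨d, hd⟩ := not_not.1 fun hnd ↦ hxE.2 ⟨hxab, hnd⟩
      exact largeOscillationSet_left_isolated Nat.one_div_pos_of_nat hxab hd
    exact (countable_iUnion hn).mono fun x hx ↦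
      mem_iUnion.2 (exists_mem_largeOscillationSet hx.1 hx.2)
end

section
/- Let a < b be real numbers and let f : [a,b] → ℝ be a bounded function which is right-hand continuous at every point of [a,b), or left-hand continuous at every point of (a,b]. Then f is Riemann integrable on [a,b]. -/
open Set Filter MeasureTheory Topology

/-- Classical Riemann integrability of `f` on `[a,b]`: there is `I : ℝ` such that for every
`ε > 0` there is `δ > 0` such that every Riemann sum of `f` over a tagged partition
`a = x 0 < x 1 < ⋯ < x n = b` of `[a,b]` of mesh `< δ`, with tags `t i ∈ [x i, x (i+1)]`,
is within `ε` of `I`. -/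
def RiemannIntegrableOn (f : ℝ → ℝ) (a b : ℝ) : Prop :=
  ∃ I : ℝ, ∀ ε : ℝ, 0 < ε → ∃ δ : ℝ, 0 < δ ∧
    ∀ (n : ℕ) (x t : ℕ → ℝ),
      0 < n → x 0 = a → x n = b →
      (∀ i < n, x i < x (i + 1)) →
      (∀ i < n, x (i + 1) - x i < δ) →
      (∀ i < n, t i ∈ Set.Icc (x i) (x (i + 1))) →
      |(∑ i ∈ Finset.range n, f (t i) * (x (i + 1) - x i)) - I| < ε

/-- A function into a metric space has at most countably many discontinuities at which it is
right-continuous. -/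
theorem countable_not_continuousAt_of_continuousWithinAt_Ioi {α β : Type*} [LinearOrder α]
    [TopologicalSpace α] [OrderTopology α] [SecondCountableTopology α] [PseudoMetricSpace β]
    (f : α → β) : {x | ContinuousWithinAt f (Ioi x) x ∧ ¬ContinuousAt f x}.Countable := by
  set s : ℕ → Set α := fun n => {x | ContinuousWithinAt f (Ioi x) x ∧
    ¬∀ᶠ y in 𝓝 x, dist (f y) (f x) < 2 * (1 / ((n : ℝ) + 1))} with hs
  have hcount (n : ℕ) : (s n).Countable := by
    suffices hisol : ∀ x ∈ s n, 𝓝[s n ∩ Ioi x] x = ⊥ from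
      Countable.mono (fun x hx => mem_sep hx (hisol x hx))
        (countable_setOfPred_isolated_right_within (s := s n))
    intro x hx
    have hpos : 0 < 1 / ((n : ℝ) + 1) := Nat.one_div_pos_of_nat
    have hnear : ∀ᶠ y in 𝓝[>] x, dist (f y) (f x) < 1 / ((n : ℝ) + 1) :=
      hx.1.eventually (Metric.ball_mem_nhds _ hpos)
    have hnot : ∀ᶠ y in 𝓝[>] x, y ∉ s n := by
      filter_upwards [eventually_eventually_nhdsWithin.2 hnear, hnear, self_mem_nhdsWithin]
        with y hy hyx hxy hys
      rw [isOpen_Ioi.nhdsWithin_eq hxy] at hy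
      refine hys.2 (hy.mono fun z hz => ?_)
      linarith [dist_triangle_right (f z) (f y) (f x)]
    have hmem : ∀ᶠ y in 𝓝[s n ∩ Ioi x] x, y ∈ s n :=
      mem_of_superset self_mem_nhdsWithin inter_subset_left
    have hnot' := hnot.filter_mono (nhdsWithin_mono x (inter_subset_right (s := s n)))
    exact eventually_false_iff_eq_bot.1 ((hmem.and hnot').mono fun y hy => hy.2 hy.1)
  refine (countable_iUnion hcount).mono fun x hx => ?_
  by_contra hxs
  simp only [hs, mem_iUnion, not_exists, mem_ofPred_eq, not_and, not_not] at hxs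
  refine hx.2 (Metric.tendsto_nhds.2 fun ε hε => ?_)
  obtain ⟨n, hn⟩ := exists_nat_one_div_lt (half_pos hε)
  exact (hxs n hx.1).mono fun y hy => by linarith

/-- A function into a metric space has at most countably many discontinuities at which it is
left-continuous. -/
theorem countable_not_continuousAt_of_continuousWithinAt_Iio {α β : Type*} [LinearOrder α]
    [TopologicalSpace α] [OrderTopology α] [SecondCountableTopology α] [PseudoMetricSpace β]
    (f : α → β) : {x | ContinuousWithinAt f (Iio x) x ∧ ¬ContinuousAt f x}.Countable :=
  countable_not_continuousAt_of_continuousWithinAt_Ioi (α := αᵒᵈ) f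

/-- The step function with value `c i` on `(x i, x (i + 1)]` for `i < n`. -/
noncomputable def stepFunction (n : ℕ) (x c : ℕ → ℝ) (s : ℝ) : ℝ :=
  ∑ i ∈ Finset.range n, (Ioc (x i) (x (i + 1))).indicator (fun _ => c i) s

theorem measurable_stepFunction (n : ℕ) (x c : ℕ → ℝ) : Measurable (stepFunction n x c) :=
  Finset.measurable_fun_sum _ fun _ _ => measurable_const.indicator measurableSet_Ioc

theorem monotoneOn_Iic_of_le_succ {n : ℕ} {x : ℕ → ℝ} (hx : ∀ i < n, x i ≤ x (i + 1)) :
    MonotoneOn x (Iic n) :=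
  monotoneOn_of_le_succ ordConnected_Iic fun i _ _ hi => hx i (Nat.lt_of_succ_le hi)

theorem stepFunction_eq_zero_of_lt {n : ℕ} {x c : ℕ → ℝ} (hx : ∀ i < n, x i ≤ x (i + 1)) {s : ℝ}
    (hs : x n < s) : stepFunction n x c s = 0 :=
  Finset.sum_eq_zero fun _ hi => indicator_of_notMem (fun h => (h.2.trans
    (monotoneOn_Iic_of_le_succ hx (Nat.succ_le_of_lt (Finset.mem_range.1 hi)) self_mem_Iic
      (Nat.succ_le_of_lt (Finset.mem_range.1 hi)))).not_gt hs) _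

theorem exists_mem_Ioc_stepFunction_eq {n : ℕ} {x : ℕ → ℝ} (c : ℕ → ℝ)
    (hx : ∀ i < n, x i ≤ x (i + 1)) {s : ℝ} (hs : s ∈ Ioc (x 0) (x n)) :
    ∃ i < n, s ∈ Ioc (x i) (x (i + 1)) ∧ stepFunction n x c s = c i := by
  induction n with
  | zero => exact absurd hs.1 hs.2.not_gt
  | succ n ih =>
    have hx' : ∀ i < n, x i ≤ x (i + 1) := fun i hi => hx i (hi.trans n.lt_succ_self)
    have hsum : stepFunction (n + 1) x c s =
        stepFunction n x c s + (Ioc (x n) (x (n + 1))).indicator (fun _ => c n) s :=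
      Finset.sum_range_succ _ _
    rcases le_or_gt s (x n) with h | h
    · obtain ⟨i, hi, hsi, he⟩ := ih hx' ⟨hs.1, h⟩
      refine ⟨i, hi.trans n.lt_succ_self, hsi, ?_⟩
      rw [hsum, he, indicator_of_notMem (fun h' => h'.1.not_ge h), add_zero]
    · refine ⟨n, n.lt_succ_self, ⟨h, hs.2⟩, ?_⟩
      rw [hsum, stepFunction_eq_zero_of_lt hx' h, zero_add,
        indicator_of_mem (show s ∈ Ioc (x n) (x (n + 1)) from ⟨h, hs.2⟩)]

theorem setIntegral_stepFunction {n : ℕ} {x : ℕ → ℝ} (c : ℕ → ℝ)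
    (hx : ∀ i < n, x i ≤ x (i + 1)) :
    ∫ s in Ioc (x 0) (x n), stepFunction n x c s =
      ∑ i ∈ Finset.range n, c i * (x (i + 1) - x i) := by
  have hmono := monotoneOn_Iic_of_le_succ hx
  simp only [stepFunction]
  rw [integral_finsetSum]
  · refine Finset.sum_congr rfl fun i hi => ?_
    have hi : i < n := Finset.mem_range.1 hi
    rw [setIntegral_indicator measurableSet_Ioc, inter_eq_self_of_subset_right
      (Ioc_subset_Ioc (hmono n.zero_le hi.le i.zero_le) (hmono hi self_mem_Iic hi)),
      setIntegral_const, Real.volume_real_Ioc_of_le (hx i hi), smul_eq_mul, mul_comm]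
  · exact fun i _ => (integrable_const _).indicator measurableSet_Ioc

/-- A bounded function which is continuous almost everywhere on `(a, b]` is Riemann integrable
on `[a, b]`. -/
theorem riemannIntegrableOn_of_ae_continuousAt {f : ℝ → ℝ} {a b C : ℝ}
    (hC : ∀ x ∈ Icc a b, |f x| ≤ C)
    (hf : ∀ᵐ x ∂volume.restrict (Ioc a b), ContinuousAt f x) : RiemannIntegrableOn f a b := by
  refine ⟨∫ s in Ioc a b, f s, fun ε hε => ?_⟩
  by_contra! hcon
  choose n x t _ h0 hb hlt hmesh ht hfar using
    fun k : ℕ => hcon (1 / ((k : ℝ) + 1)) Nat.one_div_pos_of_nat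
  have hle (k : ℕ) : ∀ i < n k, x k i ≤ x k (i + 1) := fun i hi => (hlt k i hi).le
  have htab (k i : ℕ) (hi : i < n k) : t k i ∈ Icc a b := by
    have hmono := monotoneOn_Iic_of_le_succ (hle k)
    rw [← h0 k, ← hb k]
    exact ⟨(hmono (n k).zero_le hi.le i.zero_le).trans (ht k i hi).1,
      (ht k i hi).2.trans (hmono hi self_mem_Iic hi)⟩
  have hstep (k : ℕ) (s : ℝ) (hs : s ∈ Ioc a b) : ∃ i < n k, s ∈ Ioc (x k i) (x k (i + 1)) ∧
      stepFunction (n k) (x k) (fun i => f (t k i)) s = f (t k i) :=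
    exists_mem_Ioc_stepFunction_eq _ (hle k) (by rwa [h0, hb])
  have hlim : Tendsto
      (fun k => ∫ s in Ioc a b, stepFunction (n k) (x k) (fun i => f (t k i)) s) atTop
      (𝓝 (∫ s in Ioc a b, f s)) := by
    refine tendsto_integral_of_dominated_convergence (fun _ => C)
      (fun k => (measurable_stepFunction _ _ _).aestronglyMeasurable) (integrable_const C)
      (fun k => ?_) ?_
    · filter_upwards [ae_restrict_mem measurableSet_Ioc] with s hs
      obtain ⟨i, hi, -, he⟩ := hstep k s hs
      rw [he]
      exact hC _ (htab k i hi)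
    · filter_upwards [ae_restrict_mem measurableSet_Ioc, hf] with s hs hcont
      choose i hi hsi he using fun k => hstep k s hs
      simp only [he]
      refine hcont.tendsto.comp (tendsto_iff_dist_tendsto_zero.2 ?_)
      refine squeeze_zero (fun _ => dist_nonneg) (fun k => ?_)
        (tendsto_one_div_add_atTop_nhds_zero_nat (𝕜 := ℝ))
      exact (Real.dist_le_of_mem_Icc (ht k _ (hi k)) (Ioc_subset_Icc_self (hsi k))).trans
        (hmesh k _ (hi k)).le
  obtain ⟨k, hk⟩ := (Metric.tendsto_nhds.1 hlim ε hε).exists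
  have hint := setIntegral_stepFunction (fun i => f (t k i)) (hle k)
  rw [h0, hb] at hint
  rw [hint, Real.dist_eq] at hk
  exact (hfar k).not_gt hk

/-- If `f : [a,b] → ℝ` is bounded and is right-hand continuous at every point
of `[a,b)`, or left-hand continuous at every point of `(a,b]`, then `f` is Riemann
integrable on `[a,b]`. -/
theorem riemannIntegrable_of_one_sided_continuity (a b : ℝ) (hab : a < b) (f : ℝ → ℝ)
    (hbd : ∃ C : ℝ, ∀ x ∈ Set.Icc a b, |f x| ≤ C)
    (h : (∀ x ∈ Set.Ico a b, ContinuousWithinAt f (Set.Icc x b) x) ∨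
         (∀ x ∈ Set.Ioc a b, ContinuousWithinAt f (Set.Icc a x) x)) :
    RiemannIntegrableOn f a b := by
  obtain ⟨C, hC⟩ := hbd
  refine riemannIntegrableOn_of_ae_continuousAt hC ?_
  have hb : ∀ᵐ x ∂volume.restrict (Ioc a b), x ≠ b :=
    ae_restrict_of_ae (Measure.ae_ne volume b)
  rcases h with h | h
  · filter_upwards [ae_restrict_mem measurableSet_Ioc, hb, ae_restrict_of_ae
      ((countable_not_continuousAt_of_continuousWithinAt_Ioi f).ae_notMem volume)] with x hx hxb hcount
    have hxb : x < b := hx.2.lt_of_ne hxb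
    by_contra hcont
    exact hcount ⟨(h x ⟨hx.1.le, hxb⟩).mono_of_mem_nhdsWithin (Icc_mem_nhdsGT hxb), hcont⟩
  · filter_upwards [ae_restrict_mem measurableSet_Ioc, ae_restrict_of_ae
      ((countable_not_continuousAt_of_continuousWithinAt_Iio f).ae_notMem volume)] with x hx hcount
    by_contra hcont
    exact hcount ⟨(h x hx).mono_of_mem_nhdsWithin (Icc_mem_nhdsLT hx.1), hcont⟩
end
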